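/- Let R be a commutative Noetherian ring in which there are only finitely many prime ideals of height 2. Then the Krull dimension of R is at most 2. -/

import Mathlib

/-!
A commutative Noetherian ring with only finitely many prime ideals of height `2`
has Krull dimension at most `2`.
-/

/-- The top of a chain of three primes is not minimal over the bottom one and a single element. -/
theorem Ideal.notMem_minimalPrimes_span_insert_of_lt_of_lt {R : Type*} [CommRing R]
    [IsNoetherianRing R] {a b c : Ideal R} [a.IsPrime] [b.IsPrime] (hab : a < b) (hbc : b < c)
    (x : R) : c ∉ (Ideal.span (insert x (a : Set R))).minimalPrimes := by
  intro hc
  have hb := Ideal.mem_minimalPrimes_span_of_mem_minimalPrimes_span_insert hbc x a hc a hab.le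
    fun y hy ↦ Ideal.le_radical (Ideal.subset_span (Or.inr hy))
  rw [Ideal.span_eq] at hb
  exact hab.not_ge (hb.2 ⟨inferInstance, le_rfl⟩ hab.le)

theorem PrimeSpectrum.height_lt_top {R : Type*} [CommRing R] [IsNoetherianRing R]
    (p : PrimeSpectrum R) : Order.height p < ⊤ := by
  rw [← PrimeSpectrum.height_eq_orderHeight]
  exact Ideal.height_lt_top_of_isPrime

/-- Every element of a prime of height `3` lies in a smaller prime of height `2`. -/
theorem PrimeSpectrum.exists_lt_height_eq_two_mem {R : Type*} [CommRing R] [IsNoetherianRing R]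
    {p : PrimeSpectrum R} (hp : Order.height p = 3) {x : R} (hx : x ∈ p.asIdeal) :
    ∃ q < p, Order.height q = 2 ∧ x ∈ q.asIdeal := by
  obtain ⟨b, hbp, hb⟩ := (Order.coe_lt_height_iff (n := 2) p.height_lt_top).1
    (by rw [hp]; norm_num)
  by_cases hxb : x ∈ b.asIdeal
  · exact ⟨b, hbp, hb, hxb⟩
  obtain ⟨a, hab, ha⟩ := (Order.coe_lt_height_iff (n := 1) b.height_lt_top).1
    (by rw [hb]; norm_num)
  obtain ⟨q, hq, hqp⟩ := Ideal.exists_minimalPrimes_le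
    (I := Ideal.span (insert x (a.asIdeal : Set R))) (J := p.asIdeal)
    (Ideal.span_le.2 (Set.insert_subset hx (hab.trans hbp).le))
  have hne : q ≠ p.asIdeal := by
    rintro rfl
    exact Ideal.notMem_minimalPrimes_span_insert_of_lt_of_lt (a := a.asIdeal) (b := b.asIdeal)
      hab hbp x hq
  let q' : PrimeSpectrum R := ⟨q, hq.isPrime⟩
  have hxq : x ∈ q := hq.le (Ideal.subset_span (Or.inl rfl))
  have haq : a < q' := lt_of_le_of_ne
    (fun y hy ↦ hq.le (Ideal.subset_span (Or.inr hy)))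
    (fun haq ↦ hxb (hab.le (haq ▸ hxq : x ∈ a.asIdeal)))
  have hqp' : q' < p := lt_of_le_of_ne hqp fun h ↦ hne (congrArg PrimeSpectrum.asIdeal h)
  refine ⟨q', hqp', le_antisymm ?_ ?_, hxq⟩
  · have := Order.height_strictMono hqp' q'.height_lt_top
    rw [hp] at this
    exact Order.le_of_lt_add_one (this.trans_eq (by norm_num))
  · have := Order.height_add_one_le haq
    rw [ha] at this
    exact le_trans (by norm_num) this

theorem krullDim_le_two_of_finitely_many_height_two_primes
    (R : Type) [CommRing R] [IsNoetherianRing R]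
    (h : {p : PrimeSpectrum R | Order.height p = 2}.Finite) :
    ringKrullDim R ≤ 2 := by
  by_contra! hdim
  obtain ⟨P, hP⟩ : ∃ P : PrimeSpectrum R, 2 < Order.height P := by
    by_contra! hle
    refine hdim.not_ge ?_
    rw [ringKrullDim, Order.krullDim_eq_iSup_height]
    exact iSup_le fun p ↦ WithBot.coe_le_coe.2 (hle p)
  obtain ⟨Q, hQ⟩ : ∃ Q : PrimeSpectrum R, Order.height Q = 3 := by
    rcases (Order.add_one_le_of_lt hP).eq_or_lt with h3 | h3
    · exact ⟨P, by rw [← h3]; norm_num⟩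
    · obtain ⟨Q, -, hQ⟩ := (Order.coe_lt_height_iff (n := 3) P.height_lt_top).1
        (lt_of_eq_of_lt (by norm_num) h3)
      exact ⟨Q, hQ⟩
  obtain ⟨q, hq, hQq⟩ := (Q.asIdeal.subset_union_prime_finite h (f := PrimeSpectrum.asIdeal) Q Q
    fun p _ _ _ ↦ p.isPrime).1 fun x hx ↦ by
      obtain ⟨q, -, hq, hxq⟩ := PrimeSpectrum.exists_lt_height_eq_two_mem hQ hx
      exact Set.mem_biUnion hq hxq
  have hle : Order.height Q ≤ Order.height q := Order.height_mono hQq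
  rw [hQ, hq] at hle
  exact absurd hle (by norm_num)
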